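/- Under Assumption 1, the limit Q = lim_{k→∞} (ΞW)^k exists (entrywise) and satisfies QΞ = Q and QW = Q. -/

import Mathlib

open Matrix Filter Finset

/-- `S` is an independent strongly connected component of the influence graph `G(W)`
(edge from `j` to `i` iff `W i j ≠ 0`): nonempty, in-closed and strongly connected. -/
def IsISCC {n : ℕ} (W : Matrix (Fin n) (Fin n) ℝ) (S : Set (Fin n)) : Prop :=
  S.Nonempty ∧ (∀ i ∈ S, ∀ j, W i j ≠ 0 → j ∈ S) ∧
    (∀ i ∈ S, ∀ j ∈ S, i ≠ j → ∃ m, 1 ≤ m ∧ 0 < (W ^ m) i j)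

/-- Assumption 1: every ISCC with more than one element consisting only of non-stubborn
agents contains a vertex with two closed walks of coprime lengths. -/
def Assumption1 {n : ℕ} (W : Matrix (Fin n) (Fin n) ℝ) (ξ : Fin n → ℝ) : Prop :=
  ∀ S : Set (Fin n), IsISCC W S → S.Nontrivial → (∀ i ∈ S, ξ i = 1) →
    ∃ i ∈ S, ∃ m₁ m₂ : ℕ, 1 ≤ m₁ ∧ 1 ≤ m₂ ∧ Nat.gcd m₁ m₂ = 1 ∧
      0 < (W ^ m₁) i i ∧ 0 < (W ^ m₂) i i

theorem summable_of_succ_le_mul_add {a b : ℕ → ℝ} {r : ℝ} (ha : ∀ k, 0 ≤ a k)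
    (hb0 : ∀ k, 0 ≤ b k) (hr : r < 1) (hb : Summable b)
    (h : ∀ k, a (k + 1) ≤ r * a k + b k) : Summable a := by
  refine summable_of_sum_range_le (c := (a 0 + ∑' k, b k) / (1 - r)) ha fun n => ?_
  rw [le_div_iff₀ (by linarith)]
  have h1 : ∑ k ∈ range n, a (k + 1) ≤ r * ∑ k ∈ range n, a k + ∑ k ∈ range n, b k := by
    rw [mul_sum, ← sum_add_distrib]
    exact sum_le_sum fun k _ => h k
  have h2 : ∑ k ∈ range n, b k ≤ ∑' k, b k := hb.sum_le_tsum _ fun k _ => hb0 k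
  have h3 := sum_range_succ' a n
  rw [sum_range_succ] at h3
  linarith [ha n]

section Contraction

variable {E : Type*} [NormedAddCommGroup E] [NormedSpace ℂ E] {T : Module.End ℂ E}

theorem norm_pow_apply_le_of_contraction (hT : ∀ v, ‖T v‖ ≤ ‖v‖) (k : ℕ) (v : E) :
    ‖(T ^ k) v‖ ≤ ‖v‖ := by
  induction k with
  | zero => simp
  | succ k ih =>
    rw [pow_succ', Module.End.mul_apply]
    exact (hT _).trans ih

theorem summable_norm_pow_apply_of_pow_sub_smul_eq_zero {c : ℂ} (hc : ‖c‖ < 1) (m : ℕ) :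
    ∀ v : E, ((T - c • (1 : Module.End ℂ E)) ^ m) v = 0 → Summable fun k => ‖(T ^ k) v‖ := by
  induction m with
  | zero =>
    intro v hv
    have : v = 0 := by simpa using hv
    simp [this, summable_zero]
  | succ m ih =>
    intro v hv
    rw [pow_succ, Module.End.mul_apply] at hv
    refine summable_of_succ_le_mul_add (fun _ => norm_nonneg _) (fun _ => norm_nonneg _) hc
      (ih _ hv) fun k => ?_
    have : (T ^ (k + 1)) v = c • (T ^ k) v + (T ^ k) ((T - c • (1 : Module.End ℂ E)) v) := by
      simp [pow_succ]
    rw [this, ← norm_smul]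
    exact norm_add_le _ _

/-- A contraction acts semisimply on the generalized eigenspace of `1`. -/
theorem apply_eq_self_of_pow_sub_one_eq_zero (hT : ∀ v, ‖T v‖ ≤ ‖v‖) (m : ℕ) :
    ∀ v : E, ((T - 1) ^ m) v = 0 → T v = v := by
  induction m with
  | zero =>
    intro v hv
    have : v = 0 := by simpa using hv
    simp [this]
  | succ m ih =>
    intro v hv
    rw [pow_succ, Module.End.mul_apply] at hv
    set w := (T - 1) v with hw
    have hTw : T w = w := ih _ hv
    have hTv : T v = v + w := by simp [hw]
    have hpow : ∀ k : ℕ, (T ^ k) v = v + (k : ℂ) • w := by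
      intro k
      induction k with
      | zero => simp
      | succ k ihk =>
        rw [pow_succ', Module.End.mul_apply, ihk, map_add, map_smul, hTw, hTv]
        push_cast
        module
    suffices w = 0 by rw [hTv, this, add_zero]
    by_contra hne
    have hpos : 0 < ‖w‖ := norm_pos_iff.2 hne
    obtain ⟨k, hk⟩ := exists_nat_gt (2 * ‖v‖ / ‖w‖)
    rw [div_lt_iff₀ hpos] at hk
    have h1 := norm_pow_apply_le_of_contraction hT k v
    have h2 : ‖(k : ℂ) • w‖ ≤ ‖(T ^ k) v‖ + ‖v‖ := by
      have : (k : ℂ) • w = (T ^ k) v - v := by rw [hpow]; abel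
      rw [this]
      exact norm_sub_le _ _
    rw [norm_smul, Complex.norm_natCast] at h2
    linarith

/-- If a linear contraction has no eigenvalue on the unit circle other than `1`, its powers
converge pointwise. -/
theorem exists_tendsto_pow_apply_of_contraction [FiniteDimensional ℂ E]
    (hT : ∀ v, ‖T v‖ ≤ ‖v‖) (hper : ∀ (c : ℂ) (v : E), ‖c‖ = 1 → v ≠ 0 → T v = c • v → c = 1)
    (v : E) : ∃ l, Tendsto (fun k => (T ^ k) v) atTop (nhds l) := by
  have hv : v ∈ ⨆ c : ℂ, T.maxGenEigenspace c := by
    rw [Module.End.iSup_maxGenEigenspace_eq_top]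
    trivial
  induction hv using Submodule.iSup_induction' with
  | zero => exact ⟨0, by simp⟩
  | add x y _ _ hx hy =>
    obtain ⟨a, ha⟩ := hx
    obtain ⟨b, hb⟩ := hy
    exact ⟨a + b, by simpa using ha.add hb⟩
  | mem c v hv =>
    obtain ⟨m, hm⟩ := (Module.End.mem_maxGenEigenspace _ _ _).1 hv
    by_cases hc : ‖c‖ < 1
    · exact ⟨0, tendsto_zero_iff_norm_tendsto_zero.2
        (summable_norm_pow_apply_of_pow_sub_smul_eq_zero hc m v hm).tendsto_atTop_zero⟩
    by_cases hc1 : c = 1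
    · subst hc1
      rw [one_smul] at hm
      have hTv := apply_eq_self_of_pow_sub_one_eq_zero hT m v hm
      refine ⟨v, tendsto_const_nhds.congr fun k => ?_⟩
      induction k with
      | zero => simp
      | succ k ih => rw [pow_succ, Module.End.mul_apply, hTv, ← ih]
    · have hinj : ∀ w : E, (T - c • (1 : Module.End ℂ E)) w = 0 → w = 0 := by
        intro w hw
        by_contra hne
        have hTw : T w = c • w := by simpa [sub_eq_zero] using hw
        have h1 := hT w
        rw [hTw, norm_smul] at h1
        have h2 : ‖c‖ ≤ 1 := le_of_mul_le_mul_right (by simpa using h1) (norm_pos_iff.2 hne)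
        exact hc1 (hper c w (le_antisymm h2 (not_lt.1 hc)) hne hTw)
      have hz : v = 0 := by
        clear hv
        induction m with
        | zero => simpa using hm
        | succ m ih =>
          rw [pow_succ', Module.End.mul_apply] at hm
          exact ih (hinj _ hm)
      exact ⟨0, by simp [hz]⟩

end Contraction

section Stochastic

variable {n : ℕ} {W : Matrix (Fin n) (Fin n) ℝ} {ξ : Fin n → ℝ}

theorem pow_apply_nonneg_of_nonneg (hW0 : ∀ i j, 0 ≤ W i j) (m : ℕ) (i j : Fin n) :
    0 ≤ (W ^ m) i j := by
  induction m generalizing j with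
  | zero => rw [pow_zero, one_apply]; split_ifs <;> norm_num
  | succ m ih =>
    rw [pow_succ, mul_apply]
    exact sum_nonneg fun l _ => mul_nonneg (ih l) (hW0 l j)

theorem exists_apply_ne_zero_of_row_sum (hW1 : ∀ i, ∑ j, W i j = 1) (i : Fin n) :
    ∃ j, W i j ≠ 0 := by
  by_contra! h
  simpa [h] using hW1 i

/-- A nonempty in-closed set of vertices contains an ISCC. -/
theorem exists_isISCC_subset (hW0 : ∀ i j, 0 ≤ W i j) (hW1 : ∀ i, ∑ j, W i j = 1)
    {S₀ : Set (Fin n)} (hne : S₀.Nonempty) (hcl : ∀ i ∈ S₀, ∀ j, W i j ≠ 0 → j ∈ S₀) :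
    ∃ S ⊆ S₀, IsISCC W S := by
  obtain ⟨S, hSle, hS⟩ := (Set.toFinite {S : Set (Fin n) | S.Nonempty ∧
    ∀ i ∈ S, ∀ j, W i j ≠ 0 → j ∈ S}).exists_le_minimal ⟨hne, hcl⟩
  refine ⟨S, hSle, hS.prop.1, hS.prop.2, fun i hi j hj _ => ?_⟩
  let R : Set (Fin n) := {j | j ∈ S ∧ ∃ m, 1 ≤ m ∧ 0 < (W ^ m) i j}
  have hR : R.Nonempty ∧ ∀ a ∈ R, ∀ b, W a b ≠ 0 → b ∈ R := by
    constructor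
    · obtain ⟨l, hl⟩ := exists_apply_ne_zero_of_row_sum hW1 i
      exact ⟨l, hS.prop.2 i hi l hl, 1, le_rfl, by
        rw [pow_one]; exact lt_of_le_of_ne (hW0 i l) hl.symm⟩
    · rintro a ⟨haS, m, hm, hpos⟩ b hab
      refine ⟨hS.prop.2 a haS b hab, m + 1, by omega, ?_⟩
      rw [pow_succ, mul_apply]
      exact sum_pos' (fun l _ => mul_nonneg (pow_apply_nonneg_of_nonneg hW0 m i l) (hW0 l b))
        ⟨a, mem_univ a, mul_pos hpos (lt_of_le_of_ne (hW0 a b) hab.symm)⟩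
  exact (hS.le_of_le hR (fun _ h => h.1) hj).2

theorem norm_sum_mul_le_of_row_sum (hW0 : ∀ i j, 0 ≤ W i j) (hW1 : ∀ i, ∑ j, W i j = 1)
    (v : Fin n → ℂ) (i : Fin n) : ‖∑ j, (W i j : ℂ) * v j‖ ≤ ‖v‖ := by
  calc ‖∑ j, (W i j : ℂ) * v j‖ ≤ ∑ j, W i j * ‖v‖ := by
        refine norm_sum_le_of_le _ fun j _ => ?_
        rw [norm_mul, Complex.norm_real, Real.norm_of_nonneg (hW0 i j)]
        exact mul_le_mul_of_nonneg_left (norm_le_pi_norm v j) (hW0 i j)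
    _ = ‖v‖ := by rw [← sum_mul, hW1, one_mul]

/-- At a coordinate where an eigenvector for a unit-modulus eigenvalue of `ΞW` has maximal
modulus, the agent is non-stubborn and its in-neighbours carry the rotated value. -/
theorem eigenvector_apply_of_norm_eq (hW0 : ∀ i j, 0 ≤ W i j) (hW1 : ∀ i, ∑ j, W i j = 1)
    (hξ : ∀ i, 0 ≤ ξ i ∧ ξ i ≤ 1) {c : ℂ} {v : Fin n → ℂ} (hc : ‖c‖ = 1) (hv : v ≠ 0)
    (heig : ∀ i, (ξ i : ℂ) * ∑ j, (W i j : ℂ) * v j = c * v i) {i : Fin n} (hi : ‖v i‖ = ‖v‖) :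
    ξ i = 1 ∧ ∀ j, W i j ≠ 0 → v j = c * v i := by
  have hM : 0 < ‖v‖ := norm_pos_iff.2 hv
  set u := c * v i with hu
  have hun : ‖u‖ = ‖v‖ := by rw [hu, norm_mul, hc, one_mul, hi]
  have hre : ∀ j, (v j * (starRingEnd ℂ) u).re ≤ ‖v‖ ^ 2 := by
    intro j
    refine (Complex.re_le_norm _).trans ?_
    rw [norm_mul, Complex.norm_conj, hun, sq]
    exact mul_le_mul_of_nonneg_right (norm_le_pi_norm v j) hM.le
  have hξre : ∀ j, ξ i * (v j * (starRingEnd ℂ) u).re ≤ ‖v‖ ^ 2 := fun j => by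
    linarith [mul_le_mul_of_nonneg_left (hre j) (hξ i).1,
      mul_le_mul_of_nonneg_right (hξ i).2 (sq_nonneg ‖v‖)]
  have hself : ∀ z : ℂ, (z * (starRingEnd ℂ) z).re = ‖z‖ ^ 2 := fun z => by
    rw [Complex.mul_conj, Complex.ofReal_re, Complex.normSq_eq_norm_sq]
  have hsum : ∑ j, W i j * (‖v‖ ^ 2 - ξ i * (v j * (starRingEnd ℂ) u).re) = 0 := by
    have h1 : ((ξ i : ℂ) * (∑ j, (W i j : ℂ) * v j) * (starRingEnd ℂ) u).re = ‖v‖ ^ 2 := by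
      rw [heig i, hself, hun]
    have h2 : (ξ i : ℂ) * (∑ j, (W i j : ℂ) * v j) * (starRingEnd ℂ) u
        = ∑ j, ((W i j * ξ i : ℝ) : ℂ) * (v j * (starRingEnd ℂ) u) := by
      rw [mul_sum, sum_mul]
      refine sum_congr rfl fun j _ => ?_
      push_cast
      ring
    rw [h2, Complex.re_sum] at h1
    simp only [Complex.re_ofReal_mul] at h1
    simp only [mul_sub, sum_sub_distrib, ← sum_mul, hW1, one_mul, ← mul_assoc]
    rw [h1, sub_self]
  have hzero : ∀ j, W i j ≠ 0 → ξ i * (v j * (starRingEnd ℂ) u).re = ‖v‖ ^ 2 := by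
    intro j hj
    have := (sum_eq_zero_iff_of_nonneg fun j _ =>
      mul_nonneg (hW0 i j) (sub_nonneg.2 (hξre j))).1 hsum j (mem_univ j)
    linarith [(mul_eq_zero.1 this).resolve_left hj]
  have hξ1 : ξ i = 1 := by
    obtain ⟨j, hj⟩ := exists_apply_ne_zero_of_row_sum hW1 i
    have h1 := hzero j hj
    have h2 := mul_le_mul_of_nonneg_left (hre j) (hξ i).1
    exact le_antisymm (hξ i).2 (le_of_mul_le_mul_right (by linarith) (pow_pos hM 2))
  refine ⟨hξ1, fun j hj => ?_⟩
  have h1 := hzero j hj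
  rw [hξ1, one_mul] at h1
  have h2 : ‖v j - u‖ ^ 2 ≤ 0 := by
    rw [← Complex.normSq_eq_norm_sq, Complex.normSq_sub, h1, Complex.normSq_eq_norm_sq,
      Complex.normSq_eq_norm_sq, hun]
    have := pow_le_pow_left₀ (norm_nonneg (v j)) (norm_le_pi_norm v j) 2
    linarith
  have h3 : ‖v j - u‖ = 0 := by
    exact sq_eq_zero_iff.1 (le_antisymm h2 (sq_nonneg _))
  exact sub_eq_zero.1 (norm_eq_zero.1 h3)

/-- Under Assumption 1, `1` is the only possible eigenvalue of `ΞW` on the unit circle. -/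
theorem eigenvalue_eq_one_of_norm_eq_one (hW0 : ∀ i j, 0 ≤ W i j)
    (hW1 : ∀ i, ∑ j, W i j = 1) (hξ : ∀ i, 0 ≤ ξ i ∧ ξ i ≤ 1) (hA1 : Assumption1 W ξ)
    {c : ℂ} {v : Fin n → ℂ} (hc : ‖c‖ = 1) (hv : v ≠ 0)
    (heig : ∀ i, (ξ i : ℂ) * ∑ j, (W i j : ℂ) * v j = c * v i) : c = 1 := by
  have hM : 0 < ‖v‖ := norm_pos_iff.2 hv
  have hmax := fun i (hi : ‖v i‖ = ‖v‖) => eigenvector_apply_of_norm_eq hW0 hW1 hξ hc hv heig hi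
  have hcl : ∀ i ∈ {i | ‖v i‖ = ‖v‖}, ∀ j, W i j ≠ 0 → j ∈ {i | ‖v i‖ = ‖v‖} := by
    intro i hi j hj
    change ‖v j‖ = ‖v‖
    rw [(hmax i hi).2 j hj, norm_mul, hc, one_mul]
    exact hi
  have hne : {i | ‖v i‖ = ‖v‖}.Nonempty := by
    obtain ⟨i₀, -⟩ := Function.ne_iff.1 hv
    have : Nonempty (Fin n) := ⟨i₀⟩
    obtain ⟨i, hi⟩ := Finite.exists_max fun i => ‖v i‖
    exact ⟨i, le_antisymm (norm_le_pi_norm v i) ((pi_norm_le_iff_of_nonneg (norm_nonneg _)).2 hi)⟩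
  have hwalk : ∀ (m : ℕ) (i j : Fin n), ‖v i‖ = ‖v‖ → (W ^ m) i j ≠ 0 →
      ‖v j‖ = ‖v‖ ∧ v j = c ^ m * v i := by
    intro m
    induction m with
    | zero =>
      intro i j hi hij
      rw [pow_zero, one_apply] at hij
      obtain rfl : i = j := by by_contra h; simp [h] at hij
      simp [hi]
    | succ m ih =>
      intro i j hi hij
      rw [pow_succ, mul_apply] at hij
      obtain ⟨l, -, hl⟩ := exists_ne_zero_of_sum_ne_zero hij
      obtain ⟨h1, h2⟩ := ih i l hi (left_ne_zero_of_mul hl)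
      have hlj := right_ne_zero_of_mul hl
      exact ⟨hcl l h1 j hlj, by rw [(hmax l h1).2 j hlj, h2]; ring⟩
  have hclosed : ∀ (m : ℕ) (i : Fin n), ‖v i‖ = ‖v‖ → (W ^ m) i i ≠ 0 → c ^ m = 1 := by
    intro m i hi hii
    have hvi : v i ≠ 0 := norm_pos_iff.1 (hi ▸ hM)
    exact mul_right_cancel₀ hvi (by rw [one_mul, ← (hwalk m i i hi hii).2])
  obtain ⟨S, hSS, hS⟩ := exists_isISCC_subset hW0 hW1 hne hcl
  by_cases hnt : S.Nontrivial
  · obtain ⟨i, hi, m₁, m₂, -, -, hgcd, h1, h2⟩ := hA1 S hS hnt fun i hi => (hmax i (hSS hi)).1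
    have := pow_gcd_eq_one.2 ⟨hclosed m₁ i (hSS hi) h1.ne', hclosed m₂ i (hSS hi) h2.ne'⟩
    rwa [hgcd, pow_one] at this
  · obtain ⟨i, hi⟩ := hS.1
    obtain ⟨j, hj⟩ := exists_apply_ne_zero_of_row_sum hW1 i
    obtain rfl : j = i := Set.not_nontrivial_iff.1 hnt (hS.2.1 i hi j hj) hi
    simpa using hclosed 1 j (hSS hi) (by simpa using hj)

theorem exists_tendsto_pow_diagonal_mul (hW0 : ∀ i j, 0 ≤ W i j)
    (hW1 : ∀ i, ∑ j, W i j = 1) (hξ : ∀ i, 0 ≤ ξ i ∧ ξ i ≤ 1) (hA1 : Assumption1 W ξ)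
    (i j : Fin n) : ∃ q, Tendsto (fun k => ((diagonal ξ * W) ^ k) i j) atTop (nhds q) := by
  set A : Matrix (Fin n) (Fin n) ℂ := (diagonal ξ * W).map Complex.ofRealHom with hA
  have hmul : ∀ v i, Matrix.toLin' A v i = (ξ i : ℂ) * ∑ j, (W i j : ℂ) * v j := by
    intro v i
    simp [hA, mulVec, dotProduct, mul_sum, mul_assoc, -Matrix.map_mul]
  have hcontr : ∀ v, ‖Matrix.toLin' A v‖ ≤ ‖v‖ := by
    intro v
    refine (pi_norm_le_iff_of_nonneg (norm_nonneg _)).2 fun i => ?_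
    rw [hmul, norm_mul, Complex.norm_real, Real.norm_of_nonneg (hξ i).1]
    exact (mul_le_of_le_one_left (norm_nonneg _) (hξ i).2).trans
      (norm_sum_mul_le_of_row_sum hW0 hW1 v i)
  obtain ⟨l, hl⟩ := exists_tendsto_pow_apply_of_contraction hcontr
    (fun c v hc hv h => eigenvalue_eq_one_of_norm_eq_one hW0 hW1 hξ hA1 hc hv fun i => by
      rw [← hmul, h, Pi.smul_apply, smul_eq_mul]) (Pi.single j 1)
  refine ⟨(l i).re, ((Complex.continuous_re.tendsto _).comp (tendsto_pi_nhds.1 hl i)).congr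
    fun k => ?_⟩
  have hpow : A ^ k = ((diagonal ξ * W) ^ k).map Complex.ofRealHom :=
    (map_pow Complex.ofRealHom.mapMatrix _ k).symm
  simp [← toLin'_pow, hpow]

end Stochastic

/-- Under Assumption 1, `Q = lim_k (ΞW)^k` exists entrywise and satisfies
`QΞ = Q` and `QW = Q`. -/
theorem limit_of_pow_exists_and_fixed
    (n : ℕ) (hn : 1 ≤ n)
    (W Ξ : Matrix (Fin n) (Fin n) ℝ) (ξ : Fin n → ℝ)
    (hW0 : ∀ i j, 0 ≤ W i j) (hW1 : ∀ i, ∑ j, W i j = 1)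
    (hΞ : Ξ = Matrix.diagonal ξ) (hξ : ∀ i, 0 ≤ ξ i ∧ ξ i ≤ 1)
    (hA1 : Assumption1 W ξ) :
    ∃ Q : Matrix (Fin n) (Fin n) ℝ,
      (∀ i j, Tendsto (fun k => ((Ξ * W) ^ k) i j) atTop (nhds (Q i j))) ∧
      Q * Ξ = Q ∧ Q * W = Q := by
  subst hΞ
  choose Q hQ using exists_tendsto_pow_diagonal_mul hW0 hW1 hξ hA1
  have hP0 : ∀ i j, 0 ≤ (diagonal ξ * W) i j := fun i j => by
    rw [diagonal_mul]
    exact mul_nonneg (hξ i).1 (hW0 i j)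
  have hQ0 : ∀ i j, 0 ≤ Q i j := fun i j =>
    ge_of_tendsto' (hQ i j) fun k => pow_apply_nonneg_of_nonneg hP0 k i j
  have hQP : ∀ i j, ∑ l, Q i l * (ξ l * W l j) = Q i j := by
    intro i j
    refine tendsto_nhds_unique
      ((tendsto_finsetSum univ fun l _ => (hQ i l).mul_const (ξ l * W l j)).congr fun k => ?_)
      ((hQ i j).comp (tendsto_add_atTop_nat 1))
    simp [pow_succ _ k, mul_apply (M := _ ^ k), diagonal_mul]
  have hrow : ∀ i, ∑ l, Q i l * (1 - ξ l) = 0 := by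
    intro i
    have h : ∑ l, Q i l * ξ l = ∑ j, Q i j := by
      rw [← sum_congr rfl fun j _ => hQP i j, sum_comm]
      simp only [← mul_assoc, ← mul_sum, hW1, mul_one]
    simp only [mul_sub, mul_one, sum_sub_distrib, h, sub_self]
  have hQξ : ∀ i j, Q i j * ξ j = Q i j := by
    intro i j
    have := (sum_eq_zero_iff_of_nonneg fun l _ =>
      mul_nonneg (hQ0 i l) (sub_nonneg.2 (hξ l).2)).1 (hrow i) j (mem_univ j)
    linarith
  refine ⟨of Q, hQ, ?_, ?_⟩
  · ext i j
    simpa [mul_diagonal] using hQξ i j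
  · ext i j
    rw [mul_apply, of_apply, ← hQP i j]
    refine sum_congr rfl fun l _ => ?_
    rw [of_apply, ← mul_assoc, hQξ]
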